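/- arXiv:2506.13606 — 2 statements merged into one kernel-verified Lean document; each statement's English description precedes it below -/
import Mathlib

section
/- There exist four regions F₁, F₂, F₃, F₄ in the plane forming a non-piercing family in general position, together with points a_{i,j} for all 1 ≤ i < j ≤ 4 such that a_{i,j} ∈ F_i ∩ F_j and a_{i,j} ∉ F_k for every k ∈ {1,2,3,4} \ {i,j}. Consequently the bound λ(ℱ) ≤ 4 for non-piercing families is tight. -/
open Set

/-- The plane ℝ². -/
abbrev Plane := ℝ × ℝ

/-- A Jordan curve: the image of a continuous injective map from the unit circle into ℝ². -/
def IsJordanCurve (S : Set Plane) : Prop :=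
  ∃ f : Circle → Plane, Continuous f ∧ Function.Injective f ∧ Set.range f = S

/-- A region: a compact, connected subset of ℝ² whose frontier is the union of
finitely many pairwise disjoint Jordan curves. -/
def IsRegion (F : Set Plane) : Prop :=
  IsCompact F ∧ IsConnected F ∧
    ∃ (n : ℕ) (γ : Fin n → Set Plane), (∀ i, IsJordanCurve (γ i)) ∧
      (Pairwise fun i j => Disjoint (γ i) (γ j)) ∧ frontier F = ⋃ i, γ i

/-- A family of regions is in general position if the frontiers of any two of its
members intersect in only finitely many points. -/
def GeneralPosition (ℱ : Set (Set Plane)) : Prop :=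
  ∀ F ∈ ℱ, ∀ G ∈ ℱ, F ≠ G → (frontier F ∩ frontier G).Finite

/-- A family is non-piercing if the difference of any two of its members is connected. -/
def NonPiercing (ℱ : Set (Set Plane)) : Prop :=
  ∀ F ∈ ℱ, ∀ G ∈ ℱ, F ≠ G → IsConnected (F \ G)

/-- The transversal number: the smallest cardinality of a set of points of the plane
meeting every member of the family. -/
noncomputable def transversalNumber (ℱ : Set (Set Plane)) : ℕ :=
  sInf {n | ∃ T : Finset Plane, T.card = n ∧ ∀ F ∈ ℱ, ∃ p ∈ T, p ∈ F}

/-- The matching number: the maximum number of pairwise disjoint members of the family. -/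
noncomputable def matchingNumber (ℱ : Set (Set Plane)) : ℕ :=
  sSup {n | ∃ 𝒢 : Finset (Set Plane), ↑𝒢 ⊆ ℱ ∧ 𝒢.card = n ∧
    (𝒢 : Set (Set Plane)).Pairwise Disjoint}

/-- The closed Euclidean disc with centre `c` and radius `r`. -/
def euclideanDisc (c : Plane) (r : ℝ) : Set Plane :=
  {p | (p.1 - c.1) ^ 2 + (p.2 - c.2) ^ 2 ≤ r ^ 2}

/-- The Euclidean circle with centre `c` and radius `r`. -/
def euclideanCircle (c : Plane) (r : ℝ) : Set Plane :=
  {p | (p.1 - c.1) ^ 2 + (p.2 - c.2) ^ 2 = r ^ 2}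

theorem preimage_closedBall_eq_euclideanDisc (c : Plane) {r : ℝ} (hr : 0 ≤ r) :
    Complex.equivRealProdCLM.symm.toHomeomorph ⁻¹'
      Metric.closedBall (Complex.equivRealProdCLM.symm c) r = euclideanDisc c r := by
  ext p
  simp [euclideanDisc, Complex.dist_eq_re_im, Real.sqrt_le_left hr]

theorem preimage_sphere_eq_euclideanCircle (c : Plane) {r : ℝ} (hr : 0 ≤ r) :
    Complex.equivRealProdCLM.symm.toHomeomorph ⁻¹'
      Metric.sphere (Complex.equivRealProdCLM.symm c) r = euclideanCircle c r := by
  ext p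
  rw [mem_preimage, Metric.mem_sphere, Complex.dist_eq_re_im]
  simp [euclideanCircle,
    Real.sqrt_eq_iff_eq_sq (add_nonneg (sq_nonneg _) (sq_nonneg _)) hr]

theorem frontier_euclideanDisc (c : Plane) {r : ℝ} (hr : 0 < r) :
    frontier (euclideanDisc c r) = euclideanCircle c r := by
  rw [← preimage_closedBall_eq_euclideanDisc c hr.le,
    ← preimage_sphere_eq_euclideanCircle c hr.le, ← Homeomorph.preimage_frontier,
    frontier_closedBall _ hr.ne']

theorem isCompact_euclideanDisc (c : Plane) {r : ℝ} (hr : 0 ≤ r) :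
    IsCompact (euclideanDisc c r) := by
  rw [← preimage_closedBall_eq_euclideanDisc c hr, Homeomorph.isCompact_preimage]
  exact isCompact_closedBall _ _

theorem isConnected_euclideanDisc (c : Plane) {r : ℝ} (hr : 0 ≤ r) :
    IsConnected (euclideanDisc c r) := by
  rw [← preimage_closedBall_eq_euclideanDisc c hr, Homeomorph.isConnected_preimage]
  exact (convex_closedBall _ _).isConnected (Metric.nonempty_closedBall.2 hr)

theorem isJordanCurve_euclideanCircle (c : Plane) {r : ℝ} (hr : 0 < r) :
    IsJordanCurve (euclideanCircle c r) := by
  refine ⟨fun z => (c.1 + r * (z : ℂ).re, c.2 + r * (z : ℂ).im), ?_, ?_, ?_⟩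
  · exact (continuous_const.add (continuous_const.mul
      (Complex.continuous_re.comp continuous_subtype_val))).prodMk
      (continuous_const.add (continuous_const.mul
      (Complex.continuous_im.comp continuous_subtype_val)))
  · intro z w h
    simp only [Prod.mk.injEq, add_right_inj, mul_eq_mul_left_iff, hr.ne', or_false] at h
    exact Circle.ext (Complex.ext h.1 h.2)
  · ext p
    constructor
    · rintro ⟨z, rfl⟩
      have hz := Circle.normSq_coe z
      rw [Complex.normSq_apply] at hz
      simp only [euclideanCircle, mem_ofPred_eq]
      linear_combination r ^ 2 * hz
    · intro hp
      have hw : (⟨(p.1 - c.1) / r, (p.2 - c.2) / r⟩ : ℂ) ∈ Submonoid.unitSphere ℂ := by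
        rw [← SetLike.mem_coe, Submonoid.coe_unitSphere, mem_sphere_zero_iff_norm,
          ← sq_eq_sq₀ (norm_nonneg _) zero_le_one, ← Complex.normSq_eq_norm_sq, Complex.normSq_mk]
        simp only [euclideanCircle, mem_ofPred_eq] at hp
        field_simp
        linarith
      refine ⟨⟨_, hw⟩, ?_⟩
      ext <;> simp <;> field_simp <;> ring

theorem isRegion_euclideanDisc (c : Plane) {r : ℝ} (hr : 0 < r) :
    IsRegion (euclideanDisc c r) :=
  ⟨isCompact_euclideanDisc c hr.le, isConnected_euclideanDisc c hr.le, 1,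
    fun _ => euclideanCircle c r, fun _ => isJordanCurve_euclideanCircle c hr,
    fun i j h => (h (Subsingleton.elim i j)).elim, by
      rw [frontier_euclideanDisc c hr, iUnion_const]⟩

theorem finite_euclideanCircle_inter {c d : Plane} (hcd : c ≠ d) (r s : ℝ) :
    (euclideanCircle c r ∩ euclideanCircle d s).Finite := by
  have hv : (d.1 - c.1) ^ 2 + (d.2 - c.2) ^ 2 ≠ 0 := by
    intro h
    apply hcd
    ext <;> nlinarith [sq_nonneg (d.1 - c.1), sq_nonneg (d.2 - c.2)]
  set N := (d.1 - c.1) ^ 2 + (d.2 - c.2) ^ 2 with hN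
  set K := r ^ 2 * N - ((r ^ 2 - s ^ 2 + N) / 2) ^ 2 with hK
  -- On the intersection, the inner product with `d - c` is constant, so the
  -- cross product with `d - c` takes at most two values.
  have hdot : ∀ p ∈ euclideanCircle c r ∩ euclideanCircle d s,
      (p.1 - c.1) * (d.1 - c.1) + (p.2 - c.2) * (d.2 - c.2) = (r ^ 2 - s ^ 2 + N) / 2 := by
    rintro p ⟨h₁, h₂⟩
    simp only [euclideanCircle, mem_ofPred_eq] at h₁ h₂
    linear_combination (h₁ - h₂) / 2 - hN / 2
  refine Set.Finite.of_injOn (t := {√K, -√K})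
    (f := fun p : Plane => (p.1 - c.1) * (d.2 - c.2) - (p.2 - c.2) * (d.1 - c.1))
    ?_ ?_ (Set.toFinite _)
  · intro p hp
    have h := hdot p hp
    have h₁ := hp.1
    simp only [euclideanCircle, mem_ofPred_eq] at h₁
    have hsq : ((p.1 - c.1) * (d.2 - c.2) - (p.2 - c.2) * (d.1 - c.1)) ^ 2 = K := by
      rw [hK, ← h, ← h₁, hN]
      ring
    have : 0 ≤ K := hsq ▸ sq_nonneg _
    rw [← Real.sq_sqrt this] at hsq
    exact sq_eq_sq_iff_eq_or_eq_neg.1 hsq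
  · intro p hp q hq h
    have e := (hdot p hp).trans (hdot q hq).symm
    simp only at h
    ext
    · apply mul_right_cancel₀ hv
      rw [hN]
      linear_combination (d.1 - c.1) * e + (d.2 - c.2) * h
    · apply mul_right_cancel₀ hv
      rw [hN]
      linear_combination (d.2 - c.2) * e - (d.1 - c.1) * h

/-- If the squared distance of the centres of two discs is at least the sum of the squared radii,
then the centre of the first disc lies outside the second. -/
theorem center_mem_euclideanDisc_diff {c d : Plane} {r s : ℝ} (hr : 0 < r)
    (h : r ^ 2 + s ^ 2 ≤ (c.1 - d.1) ^ 2 + (c.2 - d.2) ^ 2) :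
    c ∈ euclideanDisc c r \ euclideanDisc d s := by
  constructor
  · simp [euclideanDisc, sq_nonneg]
  · simp only [euclideanDisc, mem_ofPred_eq, not_le]
    nlinarith

/-- If the squared distance of the centres of two discs is at least the sum of the squared radii,
then their difference is star-shaped with respect to the centre of the first, hence connected. -/
theorem isConnected_euclideanDisc_diff {c d : Plane} {r s : ℝ} (hr : 0 < r)
    (h : r ^ 2 + s ^ 2 ≤ (c.1 - d.1) ^ 2 + (c.2 - d.2) ^ 2) :
    IsConnected (euclideanDisc c r \ euclideanDisc d s) := by
  have hc := center_mem_euclideanDisc_diff hr h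
  suffices hstar : StarConvex ℝ c (euclideanDisc c r \ euclideanDisc d s) from
    (hstar.isPathConnected hc).isConnected
  rintro p ⟨hp, hpd⟩ a b ha hb hab
  obtain rfl : a = 1 - b := by linarith
  simp only [euclideanDisc, mem_ofPred_eq, not_le] at hp hpd
  simp only [euclideanDisc, mem_sdiff, mem_ofPred_eq, not_le, Prod.fst_add, Prod.snd_add,
    Prod.smul_fst, Prod.smul_snd, smul_eq_mul]
  constructor
  · calc _ = b ^ 2 * ((p.1 - c.1) ^ 2 + (p.2 - c.2) ^ 2) := by ring
      _ ≤ 1 * r ^ 2 := by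
        gcongr
        nlinarith
      _ = r ^ 2 := one_mul _
  · set D := (c.1 - d.1) ^ 2 + (c.2 - d.2) ^ 2
    set P := (p.1 - d.1) ^ 2 + (p.2 - d.2) ^ 2
    set Q := (p.1 - c.1) ^ 2 + (p.2 - c.2) ^ 2
    have hQ : 0 ≤ Q := by positivity
    have key : ((1 - b) * c.1 + b * p.1 - d.1) ^ 2 + ((1 - b) * c.2 + b * p.2 - d.2) ^ 2
        = (1 - b) * (D - b * Q) + b * P := by
      simp only [D, P, Q]
      ring
    rw [key]
    rcases hb.eq_or_lt with rfl | hb'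
    · nlinarith
    · have h₁ : b * Q ≤ r ^ 2 := by nlinarith
      have h₂ : (1 - b) * s ^ 2 ≤ (1 - b) * (D - b * Q) := by gcongr; linarith
      have h₃ : b * s ^ 2 < b * P := by gcongr
      linarith

/-- There exist four distinct regions forming a non-piercing family in general position,
together with points `a i j ∈ Fᵢ ∩ Fⱼ` (for `i < j`) avoiding the other two sets.
Hence the bound `λ(ℱ) ≤ 4` for non-piercing families is tight. -/
theorem exists_nonPiercing_with_dyadicDualVC_four :
    ∃ F : Fin 4 → Set Plane, Function.Injective F ∧ (∀ i, IsRegion (F i)) ∧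
      NonPiercing (Set.range F) ∧ GeneralPosition (Set.range F) ∧
      ∃ a : Fin 4 → Fin 4 → Plane, ∀ i j : Fin 4, i < j →
        a i j ∈ F i ∧ a i j ∈ F j ∧ ∀ k : Fin 4, k ≠ i → k ≠ j → a i j ∉ F k := by
  -- A small disc surrounded by three large discs that overlap pairwise away from it.
  let c : Fin 4 → Plane := ![(0, 0), (0, 10), (9, -5), (-9, -5)]
  let r : Fin 4 → ℝ := ![2, 91 / 10, 91 / 10, 91 / 10]
  have hr : ∀ i, 0 < r i := by
    intro i
    fin_cases i <;> norm_num [r]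
  have hcr : ∀ i j, i ≠ j →
      r i ^ 2 + r j ^ 2 ≤ ((c i).1 - (c j).1) ^ 2 + ((c i).2 - (c j).2) ^ 2 := by
    intro i j hij
    fin_cases i <;> fin_cases j <;> first | exact absurd rfl hij | norm_num [r, c]
  have hne : ∀ i j, i ≠ j → c i ≠ c j := by
    intro i j hij h
    have := hcr i j hij
    rw [h] at this
    nlinarith [hr i, hr j]
  refine ⟨fun i => euclideanDisc (c i) (r i), ?_, fun i => isRegion_euclideanDisc _ (hr i),
    ?_, ?_, ?_⟩
  · intro i j h
    by_contra hij
    have hc := center_mem_euclideanDisc_diff (hr i) (hcr i j hij)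
    exact hc.2 (h.subset hc.1)
  · rintro _ ⟨i, rfl⟩ _ ⟨j, rfl⟩ h
    exact isConnected_euclideanDisc_diff (hr i) (hcr i j fun hij => h (by rw [hij]))
  · rintro _ ⟨i, rfl⟩ _ ⟨j, rfl⟩ h
    simp only [frontier_euclideanDisc _ (hr _)]
    exact finite_euclideanCircle_inter (hne i j fun hij => h (by rw [hij])) _ _
  · refine ⟨![![0, (0, 3 / 2), (27 / 20, -3 / 4), (-27 / 20, -3 / 4)],
      ![0, 0, (9 / 2, 5 / 2), (-9 / 2, 5 / 2)], ![0, 0, 0, (0, -5)], 0], ?_⟩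
    intro i j hij
    fin_cases i <;> fin_cases j <;> first
      | exact absurd hij (by decide)
      | refine ⟨?_, ?_, ?_⟩
        · norm_num [euclideanDisc, c, r]
        · norm_num [euclideanDisc, c, r]
        · intro k hki hkj
          fin_cases k <;> first
            | exact absurd rfl hki
            | exact absurd rfl hkj
            | norm_num [euclideanDisc, c, r]
end

section
/- Let γ₁, γ₂ be two simple closed curves in ℝ² (images of continuous injective maps of the unit circle) with γ₁ ≠ γ₂, whose intersection γ₁ ∩ γ₂ is a finite set, and suppose that every point p ∈ γ₁ ∩ γ₂ is a crossing point, meaning that every neighborhood of p contains points of γ₁ lying in two distinct connected components of ℝ² \ γ₂. Then the number of points in γ₁ ∩ γ₂ is even. -/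
open Set

/-- A point `p` is a crossing point of `γ₁` and `γ₂` if every neighborhood of `p`
contains points of `γ₁` lying in two distinct connected components of `ℝ² \ γ₂`. -/
def IsCrossingPoint (γ₁ γ₂ : Set Plane) (p : Plane) : Prop :=
  ∀ U ∈ nhds p, ∃ x ∈ U ∩ γ₁, ∃ y ∈ U ∩ γ₁, x ∉ γ₂ ∧ y ∉ γ₂ ∧
    connectedComponentIn γ₂ᶜ x ≠ connectedComponentIn γ₂ᶜ y

open Complex in
/-- Two continuous functions on a connected space with the same exponential that agree
at one point are equal. -/
theorem eq_of_exp_eq_exp {X : Type*} [TopologicalSpace X] [PreconnectedSpace X] {f g : X → ℂ}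
    (hf : Continuous f) (hg : Continuous g) (h : ∀ x, exp (f x) = exp (g x)) (x₀ : X)
    (h₀ : f x₀ = g x₀) : f = g :=
  isCoveringMap_exp.eq_of_comp_eq hf hg (funext fun x ↦ Subtype.ext (h x)) x₀ h₀

open Complex in
/-- A nowhere vanishing continuous function on a simply connected, locally path connected space
has a continuous logarithm. -/
theorem exists_continuous_exp_eq {X : Type*} [TopologicalSpace X] [SimplyConnectedSpace X]
    [LocallyPathConnectedSpace X] {g : X → ℂ} (hg : Continuous g) (h0 : ∀ x, g x ≠ 0) :
    ∃ f : X → ℂ, Continuous f ∧ ∀ x, exp (f x) = g x := by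
  obtain ⟨x₀⟩ : Nonempty X := inferInstance
  obtain ⟨f, ⟨-, hf⟩, -⟩ := isCoveringMapOn_exp.existsUnique_continuousMap_lifts
    (⟨g, hg⟩ : C(X, ℂ)) (exp_log (h0 x₀)) h0
  exact ⟨f, f.continuous, fun x ↦ congrFun hf x⟩

open Complex in
/-- A nowhere vanishing continuous function on the circle has a logarithm along the universal
cover, which increases by an integral multiple of `2πi` at each turn. -/
theorem exists_log_lift_circle {f : Circle → ℂ} (hf : Continuous f) (h0 : ∀ z, f z ≠ 0) :
    ∃ (L : ℝ → ℂ) (d : ℤ), Continuous L ∧ (∀ t, exp (L t) = f (Circle.exp t)) ∧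
      ∀ t, L (t + 2 * Real.pi) = L t + d * (2 * Real.pi * I) := by
  obtain ⟨L, hL, hexp⟩ := exists_continuous_exp_eq (g := fun t : ℝ ↦ f (Circle.exp t))
    (by fun_prop) (fun t ↦ h0 _)
  have key : exp (L (0 + 2 * Real.pi)) = exp (L 0) := by
    rw [hexp, hexp, Circle.exp_add, Circle.exp_two_pi, mul_one]
  obtain ⟨d, hd⟩ := exp_eq_exp_iff_exists_int.1 key
  refine ⟨L, d, hL, hexp, fun t ↦ ?_⟩
  refine congrFun (eq_of_exp_eq_exp (f := fun t ↦ L (t + 2 * Real.pi))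
    (g := fun t ↦ L t + d * (2 * Real.pi * I)) (by fun_prop) (by fun_prop) (fun t ↦ ?_) 0 hd) t
  rw [exp_add, exp_int_mul_two_pi_mul_I, mul_one, hexp, hexp, Circle.exp_add, Circle.exp_two_pi,
    mul_one]

open Complex in
/-- Any two nowhere vanishing continuous functions on the circle are multiplicatively dependent
modulo exponentials. -/
theorem exists_zpow_mul_zpow_eq_exp_circle {f g : Circle → ℂ} (hf : Continuous f)
    (hg : Continuous g) (hf0 : ∀ z, f z ≠ 0) (hg0 : ∀ z, g z ≠ 0) :
    ∃ (m n : ℤ) (l : C(Circle, ℂ)), (m ≠ 0 ∨ n ≠ 0) ∧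
      ∀ z, exp (l z) = f z ^ m * g z ^ n := by
  obtain ⟨L, d, hL, hLf, hLd⟩ := exists_log_lift_circle hf hf0
  obtain ⟨M, e, hM, hMg, hMe⟩ := exists_log_lift_circle hg hg0
  obtain ⟨m, n, hmn, h⟩ : ∃ m n : ℤ, (m ≠ 0 ∨ n ≠ 0) ∧ m * d + n * e = 0 := by
    by_cases hd : d = 0
    · exact ⟨1, 0, by simp, by simp [hd]⟩
    · exact ⟨e, -d, by simp [hd], by ring⟩
  let N : C(ℝ, ℂ) := ⟨fun t ↦ m * L t + n * M t, by fun_prop⟩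
  have hN : Function.Periodic N (2 * Real.pi) := fun t ↦ by
    have h' : (m * d + n * e : ℂ) = 0 := mod_cast h
    change m * L (t + 2 * Real.pi) + n * M (t + 2 * Real.pi) = m * L t + n * M t
    rw [hLd, hMe]
    linear_combination (2 * Real.pi * I) * h'
  have hq := Circle.isCoveringMap_exp.isQuotientMap Circle.exp_surjective
  have hfac : Function.FactorsThrough N (Circle.exp : C(ℝ, Circle)) := fun s t hst ↦ by
    obtain ⟨k, rfl⟩ := Circle.exp_eq_exp.1 hst
    exact hN.int_mul k t
  let l : C(Circle, ℂ) := Topology.IsQuotientMap.lift (f := (Circle.exp : C(ℝ, Circle))) hq N hfac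
  refine ⟨m, n, l, hmn, fun z ↦ ?_⟩
  obtain ⟨t, rfl⟩ := Circle.exp_surjective z
  have hl : l (Circle.exp t) = N t :=
    DFunLike.congr_fun
      (Topology.IsQuotientMap.lift_comp (f := (Circle.exp : C(ℝ, Circle))) hq N hfac) t
  rw [hl, ← hLf, ← hMg, ← exp_int_mul, ← exp_int_mul, ← exp_add]
  rfl

open Complex Metric in
/-- If `(z - a) ^ m` agrees far away from `a` with a function having a continuous logarithm on
the plane, then `m = 0`. -/
theorem zpow_exponent_eq_zero_of_exp_eq {a : ℂ} {m : ℤ} {R : ℝ} (hR : 0 < R) {H : ℂ → ℂ}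
    (hH : Continuous H) (h : ∀ z ∈ sphere a R, exp (H z) = (z - a) ^ m) : m = 0 := by
  let P : ℝ → ℂ := fun t ↦ a + R * exp (t * I)
  have hP : Continuous P := by fun_prop
  have hP2 : P (2 * Real.pi) = P 0 := by
    simp only [P]; push_cast; rw [exp_two_pi_mul_I]; simp
  have hlog : exp (Real.log R) = R := by rw [← ofReal_exp, Real.exp_log hR]
  have key : ∀ t : ℝ, exp (H (P t)) = exp (m * (Real.log R + t * I)) := fun t ↦ by
    rw [h _ (by simp [P, abs_of_pos hR, norm_exp_ofReal_mul_I]), exp_int_mul, exp_add, hlog]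
    simp [P]
  obtain ⟨k, hk⟩ := exp_eq_exp_iff_exists_int.1 (key 0)
  have := congrFun (eq_of_exp_eq_exp (f := fun t ↦ H (P t))
    (g := fun t : ℝ ↦ m * (Real.log R + t * I) + k * (2 * Real.pi * I)) (by fun_prop)
    (by fun_prop) (fun t ↦ by rw [exp_add, exp_int_mul_two_pi_mul_I, mul_one, key]) 0 hk)
    (2 * Real.pi)
  simp only [hP2, hk] at this
  have h2 : (m : ℂ) * (2 * Real.pi * I) = 0 := by
    push_cast at this
    linear_combination -this
  simpa [two_pi_I_ne_zero] using h2

open Complex Metric in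
/-- If `U` is a bounded open set containing `a` but not `b`, and `(z - a) ^ m * (z - b) ^ n` has
a continuous logarithm on a set containing the boundary of `U` but not `b`, then `m = 0`. -/
theorem zpow_exponent_eq_zero_of_isBounded {K U : Set ℂ} {a b : ℂ} {m n : ℤ} (hU : IsOpen U)
    (hUb : Bornology.IsBounded U) (hUK : frontier U ⊆ K) (ha : a ∈ U) (hbU : b ∉ U)
    (hbK : b ∉ K) {G : ℂ → ℂ} (hG : Continuous G)
    (h : ∀ z ∈ K, exp (G z) = (z - a) ^ m * (z - b) ^ n) : m = 0 := by
  classical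
  have hb : ∀ z ∈ closure U, z - b ≠ 0 := fun z hz h0 ↦ by
    obtain rfl := sub_eq_zero.1 h0
    exact hbK (hUK ⟨hz, by rwa [hU.interior_eq]⟩)
  have ha' : ∀ z ∈ Uᶜ, z - a ≠ 0 := fun z hz h0 ↦ by
    obtain rfl := sub_eq_zero.1 h0
    exact hz ha
  let F : ℂ → ℂ := U.piecewise (fun z ↦ exp (G z) * (z - b) ^ (-n)) (fun z ↦ (z - a) ^ m)
  have hF : Continuous F := by
    refine continuous_piecewise (fun z hz ↦ ?_) ?_ ?_
    · have := hb z (frontier_subset_closure hz)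
      rw [h z (hUK hz), mul_assoc, ← zpow_add₀ this]
      simp
    · exact (by fun_prop : Continuous fun z ↦ exp (G z)).continuousOn.mul
        ((by fun_prop : Continuous fun z : ℂ ↦ z - b).continuousOn.zpow₀ _
          fun z hz ↦ Or.inl (hb z hz))
    · rw [hU.isClosed_compl.closure_eq]
      exact (by fun_prop : Continuous fun z : ℂ ↦ z - a).continuousOn.zpow₀ _
          fun z hz ↦ Or.inl (ha' z hz)
  have hF0 : ∀ z, F z ≠ 0 := fun z ↦ by
    by_cases hz : z ∈ U
    · simpa [F, hz] using fun h0 ↦ absurd h0 (zpow_ne_zero _ (hb z (subset_closure hz)))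
    · simpa [F, hz] using zpow_ne_zero _ (ha' z hz)
  obtain ⟨H, hH, hHF⟩ := exists_continuous_exp_eq hF hF0
  obtain ⟨R, hR, hUR⟩ := hUb.subset_ball_lt 0 a
  refine zpow_exponent_eq_zero_of_exp_eq (a := a) hR hH fun z hz ↦ ?_
  have hzU : z ∉ U := fun hzU ↦ (mem_ball.1 (hUR hzU)).ne hz
  rw [hHF]
  simp [F, hzU]

theorem frontier_connectedComponentIn_compl_subset {X : Type*} [TopologicalSpace X]
    [LocallyConnectedSpace X] {K : Set X} (hK : IsClosed K) (x : X) :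
    frontier (connectedComponentIn Kᶜ x) ⊆ K := by
  intro y hy
  by_contra hyK
  have hyK' : y ∈ Kᶜ := hyK
  have ho : IsOpen (connectedComponentIn Kᶜ x) := hK.isOpen_compl.connectedComponentIn
  have hoy : IsOpen (connectedComponentIn Kᶜ y) := hK.isOpen_compl.connectedComponentIn
  obtain ⟨z, hzy, hzx⟩ := mem_closure_iff.1 hy.1 _ hoy (mem_connectedComponentIn hyK')
  have : connectedComponentIn Kᶜ x = connectedComponentIn Kᶜ y :=
    (connectedComponentIn_eq hzx).trans (connectedComponentIn_eq hzy).symm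
  apply hy.2
  rw [ho.interior_eq, this]
  exact mem_connectedComponentIn hyK'

theorem Complex.isPreconnected_compl_closedBall (R : ℝ) :
    IsPreconnected (Metric.closedBall (0 : ℂ) R)ᶜ := by
  rcases lt_or_ge R 0 with hR | hR
  · simpa [Metric.closedBall_eq_empty.2 hR] using isPreconnected_univ
  have : (Metric.closedBall (0 : ℂ) R)ᶜ =
      (fun p : ℝ × ℝ ↦ (p.1 : ℂ) * Complex.exp (p.2 * I)) '' (Ioi R ×ˢ univ) := by
    ext z
    constructor
    · intro hz
      exact ⟨(‖z‖, arg z), by simpa using hz, by simp⟩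
    · rintro ⟨⟨r, t⟩, hr, rfl⟩
      have hr' : R < r := hr.1
      simpa [norm_exp_ofReal_mul_I] using hr'.trans_le (le_abs_self r)
  rw [this]
  exact (isPreconnected_Ioi.prod isPreconnected_univ).image _
    (by fun_prop)

/-- The complement of a compact set in the plane has at most one unbounded component. -/
theorem connectedComponentIn_compl_eq_of_not_isBounded {K : Set ℂ} (hK : IsCompact K) {a b : ℂ}
    (ha : ¬ Bornology.IsBounded (connectedComponentIn Kᶜ a))
    (hb : ¬ Bornology.IsBounded (connectedComponentIn Kᶜ b)) :
    connectedComponentIn Kᶜ a = connectedComponentIn Kᶜ b := by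
  obtain ⟨R, hR⟩ := hK.isBounded.subset_closedBall 0
  have key : ∀ c, ¬ Bornology.IsBounded (connectedComponentIn Kᶜ c) →
      ∃ z ∈ (Metric.closedBall (0 : ℂ) R)ᶜ, z ∈ connectedComponentIn Kᶜ c := by
    intro c hc
    by_contra! h
    exact hc (Metric.isBounded_closedBall.subset fun z hz ↦ by
      by_contra hz'
      exact h z hz' hz)
  obtain ⟨z, hz, hza⟩ := key a ha
  obtain ⟨w, hw, hwb⟩ := key b hb
  have := (Complex.isPreconnected_compl_closedBall R).subset_connectedComponentIn hz
    (compl_subset_compl.2 hR) hw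
  rw [connectedComponentIn_eq hza, connectedComponentIn_eq hwb, connectedComponentIn_eq this]

/-- The complement of a Jordan curve has at most one bounded component. -/
theorem connectedComponentIn_compl_range_eq_of_isBounded {f : Circle → ℂ} (hf : Continuous f)
    (hinj : Function.Injective f) {a b : ℂ} (ha : a ∉ range f) (hb : b ∉ range f)
    (hab : Bornology.IsBounded (connectedComponentIn (range f)ᶜ a))
    (hbb : Bornology.IsBounded (connectedComponentIn (range f)ᶜ b)) :
    connectedComponentIn (range f)ᶜ a = connectedComponentIn (range f)ᶜ b := by
  by_contra hne
  have hK : IsClosed (range f) := (isCompact_range hf).isClosed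
  obtain ⟨m, n, l, hmn, hl⟩ := exists_zpow_mul_zpow_eq_exp_circle
    (f := fun z ↦ f z - a) (g := fun z ↦ f z - b) (by fun_prop) (by fun_prop)
    (fun z h ↦ ha ⟨z, sub_eq_zero.1 h⟩) (fun z h ↦ hb ⟨z, sub_eq_zero.1 h⟩)
  obtain ⟨G, hG⟩ := ContinuousMap.exists_extension' (hf.isClosedEmbedding hinj) l
  have hG' : ∀ z ∈ range f, Complex.exp (G z) = (z - a) ^ m * (z - b) ^ n := by
    rintro _ ⟨z, rfl⟩
    rw [← hl]
    exact congrArg Complex.exp (congrFun hG z)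
  have hm : m = 0 := zpow_exponent_eq_zero_of_isBounded hK.isOpen_compl.connectedComponentIn hab
    (frontier_connectedComponentIn_compl_subset hK a) (mem_connectedComponentIn ha)
    (fun h ↦ hne (connectedComponentIn_eq h)) hb G.continuous hG'
  have hn : n = 0 := zpow_exponent_eq_zero_of_isBounded hK.isOpen_compl.connectedComponentIn hbb
    (frontier_connectedComponentIn_compl_subset hK b) (mem_connectedComponentIn hb)
    (fun h ↦ hne (connectedComponentIn_eq h).symm) ha G.continuous
    (fun z hz ↦ (hG' z hz).trans (mul_comm _ _))
  tauto

/-- The complement of a Jordan curve has at most two components. -/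
theorem connectedComponentIn_compl_range_eq_or_eq {f : Circle → ℂ} (hf : Continuous f)
    (hinj : Function.Injective f) {a b c : ℂ} (ha : a ∉ range f) (hb : b ∉ range f)
    (hc : c ∉ range f)
    (hab : connectedComponentIn (range f)ᶜ a ≠ connectedComponentIn (range f)ᶜ b) :
    connectedComponentIn (range f)ᶜ a = connectedComponentIn (range f)ᶜ c ∨
      connectedComponentIn (range f)ᶜ b = connectedComponentIn (range f)ᶜ c := by
  by_contra! h
  have hunb {x : ℂ} := connectedComponentIn_compl_eq_of_not_isBounded (isCompact_range hf)
    (a := c) (b := x)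
  have hbdd {x y : ℂ} := connectedComponentIn_compl_range_eq_of_isBounded hf hinj
    (a := x) (b := y)
  by_cases hcB : Bornology.IsBounded (connectedComponentIn (range f)ᶜ c)
  · exact hab (connectedComponentIn_compl_eq_of_not_isBounded (isCompact_range hf)
      (fun h' ↦ h.1 (hbdd ha hc h' hcB)) (fun h' ↦ h.2 (hbdd hb hc h' hcB)))
  · exact hab (hbdd ha hb (by_contra fun h' ↦ h.1 (hunb hcB h').symm)
      (by_contra fun h' ↦ h.2 (hunb hcB h').symm))

open Filter Topology in
/-- If every punctured germ of `w` is constant, then its value does not depend on the point. -/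
theorem iff_of_eventually_nhdsNE_iff {w : ℝ → Prop} {v : ℝ → Prop}
    (h : ∀ t, ∀ᶠ s in 𝓝[≠] t, (w s ↔ v t)) (a b : ℝ) : v a ↔ v b := by
  refine isPreconnected_univ.induction₂ (fun x y ↦ (v x ↔ v y)) (fun x _ ↦ ?_)
    (fun _ _ _ _ _ _ ↦ Iff.trans) (fun _ _ _ _ ↦ Iff.symm) (mem_univ a) (mem_univ b)
  rw [nhdsWithin_univ]
  have h₁ := eventually_eventually_nhdsWithin.2 (h x)
  rw [eventually_nhdsWithin_iff] at h₁
  filter_upwards [h₁] with y hy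
  by_cases hyx : y = x
  · rw [hyx]
  · have h₂ := hy hyx
    rw [isOpen_compl_singleton.nhdsWithin_eq hyx] at h₂
    obtain ⟨s, hs₁, hs₂⟩ := ((h₂.filter_mono nhdsWithin_le_nhds).and (h y)).exists
    exact hs₁.symm.trans hs₂

open Filter Topology in
/-- A two-valued function on the line that is locally constant off a finite set `T ⊆ (0, 1)`,
changes at each point of `T` and takes the same value at `0` and `1` changes an even number of
times. -/
theorem even_card_of_iff_of_changes {c : ℝ → Prop} {T : Finset ℝ}
    (hT : ∀ t ∈ T, t ∈ Ioo (0 : ℝ) 1) (hloc : ∀ t ∉ T, ∀ᶠ s in 𝓝 t, (c t ↔ c s))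
    (hchange : ∀ t ∈ T, ∀ U ∈ 𝓝 t, ∃ x ∈ U, ∃ y ∈ U, x ∉ T ∧ y ∉ T ∧ c x ∧ ¬ c y)
    (h01 : c 0 ↔ c 1) : Even T.card := by
  classical
  let N : ℝ → ℕ := fun s ↦ (T.filter (· < s)).card
  have hN : ∀ t, ∃ ε > 0, (∀ s ∈ Ioo (t - ε) (t + ε), s ≠ t → s ∉ T) ∧
      (∀ s ∈ Ioo (t - ε) t, N s = N t) ∧
      ∀ s ∈ Ioo t (t + ε), N s = N t + if t ∈ T then 1 else 0 := by
    intro t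
    have hcl : ((T.erase t : Finset ℝ) : Set ℝ)ᶜ ∈ 𝓝 t :=
      (T.erase t).finite_toSet.isClosed.isOpen_compl.mem_nhds (by simp)
    obtain ⟨ε, hε, hsub⟩ := Metric.mem_nhds_iff.1 hcl
    rw [Real.ball_eq_Ioo] at hsub
    have hnot : ∀ s ∈ Ioo (t - ε) (t + ε), s ≠ t → s ∉ T := fun s hs hst hsT ↦
      hsub hs (by simp [hst, hsT])
    refine ⟨ε, hε, hnot, fun s hs ↦ ?_, fun s hs ↦ ?_⟩
    · refine congrArg Finset.card (Finset.filter_congr fun p hp ↦ ⟨fun h ↦ h.trans hs.2, fun h ↦ ?_⟩)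
      by_contra! hsp
      exact hnot p ⟨hs.1.trans_le hsp, by linarith⟩ h.ne hp
    · have hiff : ∀ p ∈ T, p < s ↔ p ≤ t := fun p hp ↦
        ⟨fun h ↦ by
          by_contra! htp
          exact hnot p ⟨by linarith, h.trans hs.2⟩ htp.ne' hp, fun h ↦ h.trans_lt hs.1⟩
      change (T.filter (· < s)).card = (T.filter (· < t)).card + _
      rw [Finset.filter_congr hiff]
      split_ifs with htT
      · rw [← Finset.card_insert_of_notMem (a := t) (by simp)]
        congr 1
        ext p
        simp only [Finset.mem_filter, Finset.mem_insert, le_iff_lt_or_eq]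
        grind
      · rw [add_zero]
        congr 1
        ext p
        simp only [Finset.mem_filter, le_iff_lt_or_eq]
        grind
  have hconst : ∀ {u v : ℝ}, (∀ s ∈ Ioo u v, s ∉ T) → ∀ x ∈ Ioo u v, ∀ y ∈ Ioo u v,
      (c x ↔ c y) := fun {u v} h x hx y hy ↦
    isPreconnected_Ioo.induction₂ (fun x y ↦ (c x ↔ c y))
      (fun s hs ↦ (hloc s (h s hs)).filter_mono nhdsWithin_le_nhds)
      (fun _ _ _ _ _ _ ↦ Iff.trans) (fun _ _ _ _ ↦ Iff.symm) hx hy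
  let w : ℝ → Prop := fun s ↦ (c s ↔ Even (N s))
  have hgerm : ∀ t, ∃ v : Prop, (∀ᶠ s in 𝓝[≠] t, (w s ↔ v)) ∧ (t ∉ T → (v ↔ w t)) := by
    intro t
    obtain ⟨ε, hε, hnot, hleft, hright⟩ := hN t
    have hnhds : Ioo (t - ε) (t + ε) ∈ 𝓝 t := Ioo_mem_nhds (by linarith) (by linarith)
    by_cases htT : t ∈ T
    · refine ⟨c (t - ε / 2) ↔ Even (N t), ?_, fun h ↦ absurd htT h⟩
      have hl := hconst (u := t - ε) (v := t) fun s hs ↦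
        hnot s ⟨hs.1, by linarith [hs.2]⟩ hs.2.ne
      have hr := hconst (u := t) (v := t + ε) fun s hs ↦
        hnot s ⟨by linarith [hs.1], hs.2⟩ hs.1.ne'
      have hl0 : t - ε / 2 ∈ Ioo (t - ε) t := ⟨by linarith, by linarith⟩
      have hflip : ∀ s ∈ Ioo t (t + ε), (c s ↔ ¬ c (t - ε / 2)) := by
        intro s hs
        obtain ⟨x, hx, y, hy, hxT, hyT, hcx, hcy⟩ := hchange t htT _ hnhds
        have hxt : x ≠ t := fun h ↦ hxT (h ▸ htT)
        have hyt : y ≠ t := fun h ↦ hyT (h ▸ htT)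
        rcases lt_or_gt_of_ne hxt with h | h <;> rcases lt_or_gt_of_ne hyt with h' | h'
        · exact absurd ((hl x ⟨hx.1, h⟩ y ⟨hy.1, h'⟩).1 hcx) hcy
        · have := hl x ⟨hx.1, h⟩ _ hl0
          have := hr y ⟨h', hy.2⟩ s hs
          tauto
        · have := hl y ⟨hy.1, h'⟩ _ hl0
          have := hr x ⟨h, hx.2⟩ s hs
          tauto
        · exact absurd ((hr x ⟨h, hx.2⟩ y ⟨h', hy.2⟩).1 hcx) hcy
      rw [eventually_nhdsWithin_iff]
      filter_upwards [hnhds] with s hs hst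
      rcases lt_or_gt_of_ne hst with h | h
      · simp only [w]
        rw [hleft s ⟨hs.1, h⟩, hl s ⟨hs.1, h⟩ _ hl0]
      · simp only [w]
        rw [hright s ⟨h, hs.2⟩, hflip s ⟨h, hs.2⟩, if_pos htT, Nat.even_add_one]
        tauto
    · refine ⟨w t, ?_, fun _ ↦ Iff.rfl⟩
      rw [eventually_nhdsWithin_iff]
      filter_upwards [hnhds, hloc t htT] with s hs hcs hst
      simp only [w]
      rw [← hcs]
      rcases lt_or_gt_of_ne hst with h | h
      · rw [hleft s ⟨hs.1, h⟩]
      · rw [hright s ⟨h, hs.2⟩, if_neg htT, add_zero]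
  choose v hv hvw using hgerm
  have h := iff_of_eventually_nhdsNE_iff hv 0 1
  rw [hvw 0 fun h ↦ (hT 0 h).1.false, hvw 1 fun h ↦ (hT 1 h).2.false] at h
  have hN0 : N 0 = 0 := by
    simp only [N, Finset.card_eq_zero, Finset.filter_eq_empty_iff, not_lt]
    exact fun t ht ↦ (hT t ht).1.le
  have hN1 : N 1 = T.card := by
    simp only [N]
    rw [Finset.filter_true_of_mem fun t ht ↦ (hT t ht).2]
  simp only [w, hN0, hN1, h01] at h
  have : Even 0 := Even.zero
  tauto

open Filter Topology in
/-- A two-valued function on the circle that is locally constant off a finite set and changes at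
each of its points changes an even number of times. -/
theorem even_ncard_of_changes_circle {c : Circle → Prop} {P : Set Circle} (hP : P.Finite)
    (hloc : ∀ z ∉ P, ∀ᶠ w in 𝓝 z, (c z ↔ c w))
    (hchange : ∀ z ∈ P, ∀ U ∈ 𝓝 z, ∃ x ∈ U, ∃ y ∈ U, x ∉ P ∧ y ∉ P ∧ c x ∧ ¬ c y) :
    Even P.ncard := by
  classical
  have hpi := Real.pi_pos
  have : Infinite (Ioc (-Real.pi) Real.pi) :=
    (Ioc_infinite (by linarith)).to_subtype
  have hinf : Infinite Circle := Infinite.of_injective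
    (fun x : Ioc (-Real.pi) Real.pi ↦ Circle.exp x) fun x y h ↦ by
      have := congrArg (fun z : Circle ↦ (z : ℂ).arg) h
      simp only [Circle.arg_exp x.2.1 x.2.2, Circle.arg_exp y.2.1 y.2.2] at this
      exact Subtype.ext this
  obtain ⟨z₁, hz₁⟩ := hP.exists_notMem
  let E : ℝ → Circle := fun t ↦ z₁ * Circle.exp Real.pi * Circle.exp (2 * Real.pi * t - Real.pi)
  let τ : Circle → ℝ := fun z ↦
    (Complex.arg ↑(z / (z₁ * Circle.exp Real.pi)) + Real.pi) / (2 * Real.pi)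
  have hE : Continuous E := by fun_prop
  have hEo : IsOpenMap E := by
    have h₁ : IsOpenMap fun t : ℝ ↦ 2 * Real.pi * t - Real.pi :=
      ((Homeomorph.mulLeft₀ (2 * Real.pi) (by positivity)).trans
        (Homeomorph.subRight Real.pi)).isOpenMap
    exact ((Homeomorph.mulLeft (z₁ * Circle.exp Real.pi)).isOpenMap.comp
      Circle.isCoveringMap_exp.isLocalHomeomorph.isOpenMap).comp h₁
  have hE0 : E 0 = z₁ := by simp [E]
  have hE1 : E 1 = z₁ := by
    have : 2 * Real.pi * 1 - Real.pi = Real.pi := by ring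
    simp only [E, this]
    rw [mul_assoc, ← Circle.exp_add, ← two_mul, Circle.exp_two_pi, mul_one]
  have hEτ : ∀ z, E (τ z) = z := fun z ↦ by
    have : 2 * Real.pi * τ z - Real.pi = Complex.arg ↑(z / (z₁ * Circle.exp Real.pi)) := by
      simp only [τ]; field_simp; ring
    simp only [E, this, Circle.exp_arg, mul_div_cancel]
  have hτE : ∀ t ∈ Ioo (0 : ℝ) 1, τ (E t) = t := fun t ht ↦ by
    simp only [E, τ, mul_div_cancel_left]
    rw [Circle.arg_exp (by nlinarith [ht.1]) (by nlinarith [ht.2])]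
    field_simp
    ring
  have hτ : ∀ z ∈ P, τ z ∈ Ioo (0 : ℝ) 1 := fun z hz ↦ by
    have h0 : 0 ≤ τ z := div_nonneg
      (by linarith [Complex.neg_pi_lt_arg ↑(z / (z₁ * Circle.exp Real.pi))]) (by positivity)
    have h1 : τ z ≤ 1 := by
      rw [div_le_one (by positivity)]
      linarith [Complex.arg_le_pi ↑(z / (z₁ * Circle.exp Real.pi))]
    refine ⟨h0.lt_of_ne fun h ↦ hz₁ ?_, h1.lt_of_ne fun h ↦ hz₁ ?_⟩
    · rwa [← hE0, h, hEτ]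
    · rwa [← hE1, ← h, hEτ]
  let k : ℝ → ℝ := fun t ↦ max 0 (min 1 t)
  have hk : Continuous k := by fun_prop
  have hk' : ∀ t ∈ Ioo (0 : ℝ) 1, k t = t := fun t ht ↦ by
    simp [k, ht.1.le, ht.2.le]
  have hkP : ∀ t, E (k t) ∈ P → k t = t ∧ t ∈ Ioo (0 : ℝ) 1 := fun t ht ↦ by
    by_cases h0 : t ≤ 0
    · have : k t = 0 := by simp [k, h0]
      rw [this, hE0] at ht
      exact absurd ht hz₁
    by_cases h1 : 1 ≤ t
    · have : k t = 1 := by simp [k, h1]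
      rw [this, hE1] at ht
      exact absurd ht hz₁
    have : t ∈ Ioo (0 : ℝ) 1 := ⟨not_le.1 h0, not_le.1 h1⟩
    exact ⟨hk' t this, this⟩
  have hinj : Function.Injective τ := fun x y h ↦ by rw [← hEτ x, h, hEτ]
  let T : Finset ℝ := hP.toFinset.image τ
  have hmem : ∀ t, t ∈ T ↔ E (k t) ∈ P := fun t ↦ by
    simp only [T, Finset.mem_image, Set.Finite.mem_toFinset]
    constructor
    · rintro ⟨z, hz, rfl⟩
      rwa [hk' _ (hτ z hz), hEτ]
    · intro h
      obtain ⟨h₁, h₂⟩ := hkP t h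
      exact ⟨_, h, by rw [h₁, hτE t h₂]⟩
  have hcard : P.ncard = T.card := by
    rw [Finset.card_image_of_injective _ hinj, Set.ncard_eq_toFinset_card P hP]
  rw [hcard]
  refine even_card_of_iff_of_changes (c := fun t ↦ c (E (k t))) (fun t ht ↦ ?_)
    (fun t ht ↦ ?_) (fun t ht U hU ↦ ?_) ?_
  · exact (hkP t ((hmem t).1 ht)).2
  · exact (hE.comp hk).continuousAt.eventually (hloc _ (mt (hmem t).2 ht))
  · have htP := (hmem t).1 ht
    obtain ⟨hkt, ht01⟩ := hkP t htP
    rw [hkt] at htP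
    obtain ⟨_, ⟨x, hx, rfl⟩, _, ⟨y, hy, rfl⟩, hxP, hyP, hcx, hcy⟩ := hchange _ htP _
      (hEo.image_mem_nhds (inter_mem hU (Ioo_mem_nhds ht01.1 ht01.2)))
    refine ⟨x, hx.1, y, hy.1, ?_, ?_, ?_, ?_⟩
    · rwa [hmem, hk' x hx.2]
    · rwa [hmem, hk' y hy.2]
    · rwa [hk' x hx.2]
    · rwa [hk' y hy.2]
  · have h0 : k 0 = 0 := by simp [k]
    have h1 : k 1 = 1 := by simp [k]
    simp only [h0, h1, hE0, hE1]

/-- The complement of a Jordan curve in `ℝ × ℝ` has at most two components. -/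
theorem IsJordanCurve.connectedComponentIn_compl_eq_or_eq {S : Set Plane} (hS : IsJordanCurve S)
    {a b c : Plane} (ha : a ∉ S) (hb : b ∉ S) (hc : c ∉ S)
    (hab : connectedComponentIn Sᶜ a ≠ connectedComponentIn Sᶜ b) :
    connectedComponentIn Sᶜ a = connectedComponentIn Sᶜ c ∨
      connectedComponentIn Sᶜ b = connectedComponentIn Sᶜ c := by
  obtain ⟨f, hf, hinj, rfl⟩ := hS
  let e : Plane ≃ₜ ℂ := Complex.equivRealProdCLM.symm.toHomeomorph
  have hmem : ∀ x ∉ range f, e x ∉ range (e ∘ f) := by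
    rintro x hx ⟨z, hz⟩
    exact hx ⟨z, e.injective hz⟩
  have himage : e '' (range f)ᶜ = (range (e ∘ f))ᶜ := by
    rw [image_compl_eq e.bijective, range_comp]
  have hcomp : ∀ x ∉ range f, ∀ y ∉ range f,
      (connectedComponentIn (range f)ᶜ x = connectedComponentIn (range f)ᶜ y ↔
        connectedComponentIn (range (e ∘ f))ᶜ (e x) =
          connectedComponentIn (range (e ∘ f))ᶜ (e y)) := fun x hx y hy ↦ by
    rw [← himage, ← e.image_connectedComponentIn hx, ← e.image_connectedComponentIn hy,
      e.injective.image_injective.eq_iff]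
  rw [hcomp a ha c hc, hcomp b hb c hc]
  exact connectedComponentIn_compl_range_eq_or_eq (e.continuous.comp hf) (e.injective.comp hinj)
    (hmem a ha) (hmem b hb) (hmem c hc) (mt (hcomp a ha b hb).2 hab)

/-- Two distinct simple closed curves in the plane whose intersection is finite and
consists only of crossing points intersect in an even number of points. -/
theorem even_ncard_inter_of_jordanCurves (γ₁ γ₂ : Set Plane)
    (h₁ : IsJordanCurve γ₁) (h₂ : IsJordanCurve γ₂) (hne : γ₁ ≠ γ₂)
    (hfin : (γ₁ ∩ γ₂).Finite)
    (hcross : ∀ p ∈ γ₁ ∩ γ₂, IsCrossingPoint γ₁ γ₂ p) :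
    Even (γ₁ ∩ γ₂).ncard := by
  obtain ⟨f, hf, hinj, rfl⟩ := h₁
  let P : Set Circle := f ⁻¹' γ₂
  have hPimage : f '' P = range f ∩ γ₂ := by
    rw [image_preimage_eq_inter_range, inter_comm]
  have hP : P.Finite := Finite.of_finite_image (hPimage ▸ hfin) hinj.injOn
  have hclosed : IsClosed γ₂ := by
    obtain ⟨g, hg, -, rfl⟩ := h₂
    exact (isCompact_range hg).isClosed
  rw [← hPimage, ncard_image_of_injective _ hinj]
  rcases P.eq_empty_or_nonempty with hPe | ⟨z₀, hz₀⟩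
  · simp [hPe]
  obtain ⟨_, ⟨-, a, rfl⟩, -, -, ha, -⟩ := hcross (f z₀) ⟨⟨z₀, rfl⟩, hz₀⟩ univ Filter.univ_mem
  refine even_ncard_of_changes_circle
    (c := fun z ↦ connectedComponentIn γ₂ᶜ (f z) = connectedComponentIn γ₂ᶜ (f a)) hP
    (fun z hz ↦ ?_) (fun z hz U hU ↦ ?_)
  · have hnhds : connectedComponentIn γ₂ᶜ (f z) ∈ nhds (f z) :=
      hclosed.isOpen_compl.connectedComponentIn.mem_nhds (mem_connectedComponentIn hz)
    filter_upwards [hf.continuousAt hnhds] with w hw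
    rw [connectedComponentIn_eq hw]
  · rw [(hf.isClosedEmbedding hinj).isInducing.nhds_eq_comap] at hU
    obtain ⟨V, hV, hVU⟩ := hU
    obtain ⟨_, ⟨hxV, x, rfl⟩, _, ⟨hyV, y, rfl⟩, hx, hy, hxy⟩ := hcross (f z) ⟨⟨z, rfl⟩, hz⟩ V hV
    rcases h₂.connectedComponentIn_compl_eq_or_eq hx hy ha hxy with h | h
    · exact ⟨x, hVU hxV, y, hVU hyV, hx, hy, h, fun h' ↦ hxy (h.trans h'.symm)⟩
    · exact ⟨y, hVU hyV, x, hVU hxV, hy, hx, h, fun h' ↦ hxy (h'.trans h.symm)⟩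
end
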